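/- Let (x,y) ∈ B×B be admissible for the D^(1)_n tropical R and set (x′,y′) = R(x,y) (assume also that (x′,y′) is admissible). Then: (i) x_n = y_n = 1 if and only if x′_n = y′_n = 1; (ii) (x_1, y_1) = (x̄_1, ȳ_1) if and only if (x′_1, y′_1) = (x̄′_1, ȳ′_1). -/

import Mathlib

/-- The level `ℓ(x)` of an element of `B`, represented by the pair of families
`x = (x_1,…,x_n)` and `xb = (x̄_1,…,x̄_{n-1})`. -/
def lev {F : Type*} [Field F] (n : ℕ) (x xb : ℕ → F) : F :=
  (∏ i ∈ Finset.Icc 1 n, x i) * ∏ i ∈ Finset.Icc 1 (n - 1), xb i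

/-- The functions `V_0, V_1, …, V_{n-1}` of the `D^(1)_n` tropical `R`. -/
def Vf {F : Type*} [Field F] (n : ℕ) (x xb y yb : ℕ → F) : ℕ → F
  | 0 =>
      lev n x xb * (y 1 / yb 1)
      + lev n x xb *
          ∑ m ∈ Finset.Icc 2 (n - 1), (∏ i ∈ Finset.Icc 1 (m - 1), y i / x i) * (1 + y m / yb m)
      + x n * y n * ∏ i ∈ Finset.Icc 1 (n - 1), xb i * y i
      + lev n y yb * (xb 1 / x 1)
      + lev n y yb *
          ∑ m ∈ Finset.Icc 2 (n - 1), (∏ i ∈ Finset.Icc 1 (m - 1), xb i / yb i) * (1 + xb m / x m)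
      + ∏ i ∈ Finset.Icc 1 (n - 1), xb i * y i
  | (i + 1) =>
      if i + 1 = n - 1 then
        (yb (i + 1) / y n) * (y n * Vf n x xb y yb i / xb (i + 1)
          + (lev n x xb - lev n y yb) * (y n / x (i + 1) + 1 / yb (i + 1)))
      else
        yb (i + 1) * (Vf n x xb y yb i / xb (i + 1)
          + (lev n x xb - lev n y yb) * (1 / x (i + 1) + 1 / yb (i + 1)))

/-- `σ_1` (first component): swap the indices `1` of the two families. -/
def sw1 {F : Type*} (x xb : ℕ → F) : ℕ → F := fun i => if i = 1 then xb 1 else x i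

/-- `σ_n` on the unbarred family. -/
def snx {F : Type*} [Field F] (n : ℕ) (x : ℕ → F) : ℕ → F :=
  fun i => if i = n - 1 then x (n - 1) * x n else if i = n then (x n)⁻¹ else x i

/-- `σ_n` on the barred family. -/
def snxb {F : Type*} [Field F] (n : ℕ) (x xb : ℕ → F) : ℕ → F :=
  fun i => if i = n - 1 then xb (n - 1) * x n else xb i

/-- `σ✶` (unbarred part of the first component of `σ✶(x,y)`, built from `y`). -/
def stx {F : Type*} (n : ℕ) (y yb : ℕ → F) : ℕ → F := fun i => if i = n then y n else yb i

/-- `V_i^{σ_1}`. -/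
def Vs1 {F : Type*} [Field F] (n : ℕ) (x xb y yb : ℕ → F) : ℕ → F :=
  Vf n (sw1 x xb) (sw1 xb x) (sw1 y yb) (sw1 yb y)

/-- `V_i^{σ_n}`. -/
def Vsn {F : Type*} [Field F] (n : ℕ) (x xb y yb : ℕ → F) : ℕ → F :=
  Vf n (snx n x) (snxb n x xb) (snx n y) (snxb n y yb)

/-- `V_i^{σ✶}`. -/
def Vst {F : Type*} [Field F] (n : ℕ) (x xb y yb : ℕ → F) : ℕ → F :=
  Vf n (stx n y yb) y (stx n x xb) x

/-- The functions `U_1, …, U_{n-1}` of the `D^(1)_n` tropical `R`. -/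
def Uf {F : Type*} [Field F] (n : ℕ) (x xb y yb : ℕ → F) : ℕ → F := fun i =>
  if i = 1 then Vf n x xb y yb 0 * Vs1 n x xb y yb 0
  else if i = n - 1 then Vf n x xb y yb (n - 1) * Vst n x xb y yb (n - 1)
  else (1 / x i + 1 / yb i)⁻¹ *
    (Vf n x xb y yb i * Vst n x xb y yb (i - 1) / y i
      + Vf n x xb y yb (i - 1) * Vst n x xb y yb i / xb i)

/-- unbarred part `x'` of the output of the tropical `R`. -/
def Rx {F : Type*} [Field F] (n : ℕ) (x xb y yb : ℕ → F) : ℕ → F := fun i =>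
  if i = 1 then y 1 * Vs1 n x xb y yb 0 / Vf n x xb y yb 1
  else if i = n then y n * Vf n x xb y yb (n - 1) / Vsn n x xb y yb (n - 1)
  else y i * Vf n x xb y yb (i - 1) * Uf n x xb y yb i
        / (Vf n x xb y yb i * Uf n x xb y yb (i - 1))

/-- barred part `x̄'` of the output of the tropical `R`. -/
def Rxb {F : Type*} [Field F] (n : ℕ) (x xb y yb : ℕ → F) : ℕ → F := fun i =>
  if i = 1 then yb 1 * Vf n x xb y yb 0 / Vf n x xb y yb 1
  else yb i * Vf n x xb y yb (i - 1) / Vf n x xb y yb i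

/-- unbarred part `y'` of the output of the tropical `R`. -/
def Ry {F : Type*} [Field F] (n : ℕ) (x xb y yb : ℕ → F) : ℕ → F := fun i =>
  if i = 1 then x 1 * Vf n x xb y yb 0 / Vst n x xb y yb 1
  else if i = n then x n * Vsn n x xb y yb (n - 1) / Vf n x xb y yb (n - 1)
  else x i * Vst n x xb y yb (i - 1) / Vst n x xb y yb i

/-- barred part `ȳ'` of the output of the tropical `R`. -/
def Ryb {F : Type*} [Field F] (n : ℕ) (x xb y yb : ℕ → F) : ℕ → F := fun i =>
  if i = 1 then xb 1 * Vs1 n x xb y yb 0 / Vst n x xb y yb 1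
  else xb i * Vst n x xb y yb (i - 1) * Uf n x xb y yb i
        / (Vst n x xb y yb i * Uf n x xb y yb (i - 1))

/-- Admissibility: all the quantities `V_i`, `U_i` and their `σ`-transforms appearing in
the formulas of the tropical `R` are nonzero. -/
def Adm {F : Type*} [Field F] (n : ℕ) (x xb y yb : ℕ → F) : Prop :=
  (∀ i ≤ n - 1, Vf n x xb y yb i ≠ 0) ∧
  (∀ i ≤ n - 1, Vst n x xb y yb i ≠ 0) ∧
  Vs1 n x xb y yb 0 ≠ 0 ∧
  Vsn n x xb y yb (n - 1) ≠ 0 ∧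
  (∀ i, 1 ≤ i → i ≤ n - 1 → Uf n x xb y yb i ≠ 0)

/-- The unbarred part of `[μ; τ, C, τ']`. -/
def brkX {F : Type*} [Field F] (n : ℕ) (μ τ C τ' : ℕ → F) : ℕ → F := fun i =>
  if i = 1 then (μ 1)⁻¹ * (τ 0 * τ' 1 / C 1)
  else if i = 2 then (μ 2)⁻¹ * (C 1 * τ' 2 / (C 2 * τ' 0 * τ' 1))
  else if i = n - 1 then (μ (n - 1))⁻¹ * (C (n - 2) * τ' (n - 1) / (τ (n - 1) * τ' (n - 2)))
  else if i = n then (μ n)⁻¹ * (τ (n - 1) * τ' n / (τ n * τ' (n - 1)))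
  else (μ i)⁻¹ * (C (i - 1) * τ' i / (C i * τ' (i - 1)))

/-- The barred part of `[μ; τ, C, τ']` (here `μb` is the barred part of `μ`). -/
def brkXb {F : Type*} [Field F] (n : ℕ) (μb τ C τ' : ℕ → F) : ℕ → F := fun i =>
  if i = 1 then (μb 1)⁻¹ * (τ 1 * τ' 0 / C 1)
  else if i = 2 then (μb 2)⁻¹ * (C 1 * τ 2 / (C 2 * τ 0 * τ 1))
  else if i = n - 1 then (μb (n - 1))⁻¹ * (C (n - 2) * τ n / (τ (n - 2) * τ' n))
  else (μb i)⁻¹ * (C (i - 1) * τ i / (C i * τ (i - 1)))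

/-- Rescaling the first factor of a product over `Icc 1 k` rescales the product. -/
lemma prod_Icc_one_of_scale_first {M : Type*} [CommMonoid M] {f g : ℕ → M} {c : M} {k : ℕ}
    (hk : 1 ≤ k) (h1 : g 1 = c * f 1) (h : ∀ i, i ≠ 1 → g i = f i) :
    ∏ i ∈ Finset.Icc 1 k, g i = c * ∏ i ∈ Finset.Icc 1 k, f i := by
  induction k, hk using Nat.le_induction with
  | base => simp [h1]
  | succ k hk ih =>
    rw [Finset.prod_Icc_succ_top (by omega), Finset.prod_Icc_succ_top (by omega), ih,
      h (k + 1) (by omega), mul_assoc]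

/-- If `ȳ_1 = r y_1` and `x_1 = r x̄_1`, then `V_0^{σ_1} = r² V_0`. -/
lemma Vs1_zero_eq {F : Type*} [Field F] {n : ℕ} (hn : 2 ≤ n) {x xb y yb : ℕ → F} {r : F}
    (hr : r ≠ 0) (hxb : xb 1 ≠ 0) (hy : y 1 ≠ 0)
    (hxr : x 1 = r * xb 1) (hyr : yb 1 = r * y 1) :
    Vs1 n x xb y yb 0 = r ^ 2 * Vf n x xb y yb 0 := by
  have hlx : lev n (sw1 x xb) (sw1 xb x) = lev n x xb := by
    unfold lev
    rw [prod_Icc_one_of_scale_first (f := x) (g := sw1 x xb) (c := r⁻¹) (by omega)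
        (by simp [sw1, hxr, hr]) (by intro i hi; simp [sw1, hi]),
      prod_Icc_one_of_scale_first (f := xb) (g := sw1 xb x) (c := r) (by omega)
        (by simp [sw1, hxr]) (by intro i hi; simp [sw1, hi])]
    field_simp
  have hly : lev n (sw1 y yb) (sw1 yb y) = lev n y yb := by
    unfold lev
    rw [prod_Icc_one_of_scale_first (f := y) (g := sw1 y yb) (c := r) (by omega)
        (by simp [sw1, hyr]) (by intro i hi; simp [sw1, hi]),
      prod_Icc_one_of_scale_first (f := yb) (g := sw1 yb y) (c := r⁻¹) (by omega)
        (by simp [sw1, hyr, hr]) (by intro i hi; simp [sw1, hi])]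
    field_simp
  have hprod : ∏ i ∈ Finset.Icc 1 (n - 1), sw1 xb x i * sw1 y yb i
      = r ^ 2 * ∏ i ∈ Finset.Icc 1 (n - 1), xb i * y i :=
    prod_Icc_one_of_scale_first (by omega) (by simp [sw1, hxr, hyr]; ring)
      (by intro i hi; simp [sw1, hi])
  have hsum₁ : ∑ m ∈ Finset.Icc 2 (n - 1), (∏ i ∈ Finset.Icc 1 (m - 1),
        sw1 y yb i / sw1 x xb i) * (1 + sw1 y yb m / sw1 yb y m)
      = r ^ 2 * ∑ m ∈ Finset.Icc 2 (n - 1),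
        (∏ i ∈ Finset.Icc 1 (m - 1), y i / x i) * (1 + y m / yb m) := by
    rw [Finset.mul_sum]
    refine Finset.sum_congr rfl fun m hm => ?_
    have hm2 := (Finset.mem_Icc.1 hm).1
    rw [prod_Icc_one_of_scale_first (f := fun i => y i / x i) (c := r ^ 2) (by omega)
        (by simp only [sw1, hxr, hyr, if_true]; field_simp) (by intro i hi; simp [sw1, hi])]
    simp [sw1, show m ≠ 1 by omega, mul_assoc]
  have hsum₂ : ∑ m ∈ Finset.Icc 2 (n - 1), (∏ i ∈ Finset.Icc 1 (m - 1),
        sw1 xb x i / sw1 yb y i) * (1 + sw1 xb x m / sw1 x xb m)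
      = r ^ 2 * ∑ m ∈ Finset.Icc 2 (n - 1),
        (∏ i ∈ Finset.Icc 1 (m - 1), xb i / yb i) * (1 + xb m / x m) := by
    rw [Finset.mul_sum]
    refine Finset.sum_congr rfl fun m hm => ?_
    have hm2 := (Finset.mem_Icc.1 hm).1
    rw [prod_Icc_one_of_scale_first (f := fun i => xb i / yb i) (c := r ^ 2) (by omega)
        (by simp only [sw1, hxr, hyr, if_true]; field_simp) (by intro i hi; simp [sw1, hi])]
    simp [sw1, show m ≠ 1 by omega, mul_assoc]
  have hyq : sw1 y yb 1 / sw1 yb y 1 = r ^ 2 * (y 1 / yb 1) := by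
    simp only [sw1, hyr, if_true]; field_simp
  have hxq : sw1 xb x 1 / sw1 x xb 1 = r ^ 2 * (xb 1 / x 1) := by
    simp only [sw1, hxr, if_true]; field_simp
  have hnx : sw1 x xb n = x n := by simp [sw1, show n ≠ 1 by omega]
  have hny : sw1 y yb n = y n := by simp [sw1, show n ≠ 1 by omega]
  simp only [Vs1, Vf]
  rw [hlx, hly, hprod, hsum₁, hsum₂, hyq, hxq, hnx, hny]
  ring

/-- The level is invariant under `σ_n`. -/
lemma lev_snx {F : Type*} [Field F] {n : ℕ} (hn : 2 ≤ n) (x xb : ℕ → F) (hx : x n ≠ 0) :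
    lev n (snx n x) (snxb n x xb) = lev n x xb := by
  obtain ⟨k, rfl⟩ : ∃ k, n = k + 2 := ⟨n - 2, by omega⟩
  have h₁ : ∏ i ∈ Finset.Icc 1 k, snx (k + 2) x i = ∏ i ∈ Finset.Icc 1 k, x i :=
    Finset.prod_congr rfl fun i hi => by
      have := (Finset.mem_Icc.1 hi).2
      simp [snx, show i ≠ k + 1 by omega, show i ≠ k + 2 by omega]
  have h₂ : ∏ i ∈ Finset.Icc 1 k, snxb (k + 2) x xb i = ∏ i ∈ Finset.Icc 1 k, xb i :=
    Finset.prod_congr rfl fun i hi => by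
      have := (Finset.mem_Icc.1 hi).2
      simp [snxb, show i ≠ k + 1 by omega]
  simp only [lev, show k + 2 - 1 = k + 1 from rfl]
  rw [Finset.prod_Icc_succ_top (by omega), Finset.prod_Icc_succ_top (by omega),
    Finset.prod_Icc_succ_top (by omega), Finset.prod_Icc_succ_top (by omega),
    Finset.prod_Icc_succ_top (by omega), Finset.prod_Icc_succ_top (by omega), h₁, h₂]
  simp only [snx, snxb, show k + 2 - 1 = k + 1 from rfl, if_true,
    show k + 1 + 1 = k + 2 from rfl, show k + 2 ≠ k + 1 by omega, if_false]
  field_simp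

/-- `V_0` is invariant under `σ_n`. -/
lemma Vsn_zero {F : Type*} [Field F] {n : ℕ} (hn : 3 ≤ n) {x xb y yb : ℕ → F}
    (hx : x n ≠ 0) (hy : y n ≠ 0) :
    Vsn n x xb y yb 0 = Vf n x xb y yb 0 := by
  have hxi : ∀ i, i < n - 1 → snx n x i = x i := fun i hi => by
    simp [snx, show i ≠ n - 1 by omega, show i ≠ n by omega]
  have hyi : ∀ i, i < n - 1 → snx n y i = y i := fun i hi => by
    simp [snx, show i ≠ n - 1 by omega, show i ≠ n by omega]
  have hxbi : ∀ i, i < n - 1 → snxb n x xb i = xb i := fun i hi => by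
    simp [snxb, show i ≠ n - 1 by omega]
  have hybi : ∀ i, i < n - 1 → snxb n y yb i = yb i := fun i hi => by
    simp [snxb, show i ≠ n - 1 by omega]
  have hxm : snx n x n = (x n)⁻¹ := by simp [snx, show n ≠ n - 1 by omega]
  have hym : snx n y n = (y n)⁻¹ := by simp [snx, show n ≠ n - 1 by omega]
  have hprod : ∏ i ∈ Finset.Icc 1 (n - 1), snxb n x xb i * snx n y i
      = x n * y n * ∏ i ∈ Finset.Icc 1 (n - 1), xb i * y i := by
    obtain ⟨k, rfl⟩ : ∃ k, n = k + 2 := ⟨n - 2, by omega⟩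
    simp only [show k + 2 - 1 = k + 1 from rfl] at *
    rw [Finset.prod_Icc_succ_top (by omega), Finset.prod_Icc_succ_top (by omega),
      Finset.prod_congr (g := fun i => xb i * y i) rfl fun i hi => by
        have := (Finset.mem_Icc.1 hi).2
        rw [hxbi i (by omega), hyi i (by omega)]]
    simp only [snx, snxb, show k + 2 - 1 = k + 1 from rfl, if_true]
    ring
  have hsum₁ : ∑ m ∈ Finset.Icc 2 (n - 1), (∏ i ∈ Finset.Icc 1 (m - 1),
        snx n y i / snx n x i) * (1 + snx n y m / snxb n y yb m)
      = ∑ m ∈ Finset.Icc 2 (n - 1),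
        (∏ i ∈ Finset.Icc 1 (m - 1), y i / x i) * (1 + y m / yb m) := by
    refine Finset.sum_congr rfl fun m hm => ?_
    have hm' := Finset.mem_Icc.1 hm
    congr 1
    · refine Finset.prod_congr rfl fun i hi => ?_
      have := Finset.mem_Icc.1 hi
      rw [hxi i (by omega), hyi i (by omega)]
    · rcases hm'.2.lt_or_eq with h | rfl
      · rw [hyi m h, hybi m h]
      · simp [snx, snxb, mul_div_mul_right _ _ hy]
  have hsum₂ : ∑ m ∈ Finset.Icc 2 (n - 1), (∏ i ∈ Finset.Icc 1 (m - 1),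
        snxb n x xb i / snxb n y yb i) * (1 + snxb n x xb m / snx n x m)
      = ∑ m ∈ Finset.Icc 2 (n - 1),
        (∏ i ∈ Finset.Icc 1 (m - 1), xb i / yb i) * (1 + xb m / x m) := by
    refine Finset.sum_congr rfl fun m hm => ?_
    have hm' := Finset.mem_Icc.1 hm
    congr 1
    · refine Finset.prod_congr rfl fun i hi => ?_
      have := Finset.mem_Icc.1 hi
      rw [hxbi i (by omega), hybi i (by omega)]
    · rcases hm'.2.lt_or_eq with h | rfl
      · rw [hxi m h, hxbi m h]
      · simp [snx, snxb, mul_div_mul_right _ _ hx]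
  simp only [Vsn, Vf]
  rw [lev_snx (by omega) x xb hx, lev_snx (by omega) y yb hy, hprod, hsum₁, hsum₂,
    hxi 1 (by omega), hyi 1 (by omega), hxbi 1 (by omega), hybi 1 (by omega), hxm, hym]
  field_simp
  ring

/-- `V_i` is invariant under `σ_n` for `i ≤ n - 2`. -/
lemma Vsn_eq_Vf {F : Type*} [Field F] {n : ℕ} (hn : 3 ≤ n) {x xb y yb : ℕ → F}
    (hx : x n ≠ 0) (hy : y n ≠ 0) {i : ℕ} (hi : i < n - 1) :
    Vsn n x xb y yb i = Vf n x xb y yb i := by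
  induction i with
  | zero => exact Vsn_zero hn hx hy
  | succ i ih =>
    have h := ih (by omega)
    simp only [Vsn] at h ⊢
    simp only [Vf]
    rw [if_neg (by omega), if_neg (by omega), h, lev_snx (by omega) x xb hx,
      lev_snx (by omega) y yb hy]
    simp [snx, snxb, show i + 1 ≠ n - 1 by omega, show i + 1 ≠ n by omega]

/-- If `x_n y_n = 1`, then `V_{n-1}^{σ_n} = y_n² V_{n-1}`. -/
lemma Vsn_last_eq {F : Type*} [Field F] {n : ℕ} (hn : 3 ≤ n) {x xb y yb : ℕ → F}
    (hxy : x n * y n = 1) (hyb : yb (n - 1) ≠ 0) :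
    Vsn n x xb y yb (n - 1) = y n ^ 2 * Vf n x xb y yb (n - 1) := by
  have hx : x n ≠ 0 := left_ne_zero_of_mul_eq_one hxy
  have hy : y n ≠ 0 := right_ne_zero_of_mul_eq_one hxy
  obtain ⟨k, rfl⟩ : ∃ k, n = k + 2 := ⟨n - 2, by omega⟩
  have h := Vsn_eq_Vf hn (xb := xb) (yb := yb) hx hy (i := k) (by omega)
  simp only [show k + 2 - 1 = k + 1 from rfl, Vsn] at *
  simp only [Vf]
  rw [if_pos (by omega), if_pos (by omega), h, lev_snx (by omega) x xb hx,
    lev_snx (by omega) y yb hy]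
  simp only [snx, snxb, show k + 2 - 1 = k + 1 from rfl, if_true,
    show k + 2 ≠ k + 1 by omega, if_false]
  rw [eq_inv_of_mul_eq_one_left hxy]
  generalize lev (k + 2) x xb - lev (k + 2) y yb = d
  simp only [div_eq_mul_inv, mul_inv, inv_inv, one_mul]
  field_simp

theorem stmt14 {F : Type*} [Field F] (n : ℕ) (hn : 4 ≤ n)
    (x xb y yb : ℕ → F)
    (hx : ∀ i, 1 ≤ i → i ≤ n → x i ≠ 0) (hxb : ∀ i, 1 ≤ i → i ≤ n - 1 → xb i ≠ 0)
    (hy : ∀ i, 1 ≤ i → i ≤ n → y i ≠ 0) (hyb : ∀ i, 1 ≤ i → i ≤ n - 1 → yb i ≠ 0)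
    (hadm : Adm n x xb y yb)
    (hadm' : Adm n (Rx n x xb y yb) (Rxb n x xb y yb) (Ry n x xb y yb) (Ryb n x xb y yb)) :
    ((x n = 1 ∧ y n = 1) ↔ (Rx n x xb y yb n = 1 ∧ Ry n x xb y yb n = 1)) ∧
    ((x 1 = xb 1 ∧ y 1 = yb 1) ↔
      (Rx n x xb y yb 1 = Rxb n x xb y yb 1 ∧ Ry n x xb y yb 1 = Ryb n x xb y yb 1)) := by
  obtain ⟨hV, hVst, hVs1, hVsn, -⟩ := hadm
  have hV0 := hV 0 (by omega)
  have hV1 := hV 1 (by omega)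
  have hVl := hV (n - 1) le_rfl
  have hVst1 := hVst 1 (by omega)
  have hRxn : Rx n x xb y yb n = y n * Vf n x xb y yb (n - 1) / Vsn n x xb y yb (n - 1) := by
    simp [Rx, show n ≠ 1 by omega]
  have hRyn : Ry n x xb y yb n = x n * Vsn n x xb y yb (n - 1) / Vf n x xb y yb (n - 1) := by
    simp [Ry, show n ≠ 1 by omega]
  have hyb' := hyb (n - 1) (by omega) le_rfl
  have hy1 := hy 1 le_rfl (by omega)
  have hxb1 := hxb 1 le_rfl (by omega)
  have hyb1 := hyb 1 le_rfl (by omega)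
  have hyn := hy n (by omega) le_rfl
  refine ⟨?_, ?_⟩
  · rw [hRxn, hRyn, div_eq_one_iff_eq hVsn, div_eq_one_iff_eq hVl]
    refine ⟨fun ⟨hxn, hyn⟩ => ?_, fun ⟨h₁, h₂⟩ => ?_⟩
    · rw [Vsn_last_eq (by omega) (by rw [hxn, hyn, one_mul]) hyb', hxn, hyn]
      simp
    · have hxy : x n * y n = 1 := by
        refine mul_right_cancel₀ hVl ?_
        rw [mul_assoc, h₁, h₂, one_mul]
      rw [Vsn_last_eq (by omega) hxy hyb'] at h₁
      have hyn1 : y n = 1 := by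
        refine (mul_left_cancel₀ hyn (mul_right_cancel₀ hVl ?_)).symm
        rw [mul_one, h₁, sq]
      exact ⟨by simpa [hyn1] using hxy, hyn1⟩
  · simp only [Rx, Rxb, Ry, Ryb, if_true]
    rw [div_left_inj' hV1, div_left_inj' hVst1]
    refine ⟨fun ⟨hx, hy⟩ => ?_, fun ⟨h₁, h₂⟩ => ?_⟩
    · rw [Vs1_zero_eq (r := 1) (by omega) one_ne_zero hxb1 hy1 (by rw [hx, one_mul])
        (by rw [hy, one_mul]), hx, hy]
      simp
    · have hyr : yb 1 = yb 1 / y 1 * y 1 := by field_simp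
      have hr : yb 1 / y 1 = Vs1 n x xb y yb 0 / Vf n x xb y yb 0 := by
        rw [div_eq_div_iff hy1 hV0, ← h₁, mul_comm]
      have hxr : x 1 = yb 1 / y 1 * xb 1 := by
        rw [hr, div_mul_eq_mul_div, eq_div_iff hV0, h₂, mul_comm]
      have hr0 : yb 1 / y 1 ≠ 0 := div_ne_zero hyb1 hy1
      have hs := Vs1_zero_eq (n := n) (by omega) hr0 hxb1 hy1 hxr hyr
      have hr1 : yb 1 / y 1 = 1 := by
        rw [hs, mul_div_cancel_right₀ _ hV0, sq] at hr
        exact (mul_left_cancel₀ hr0 ((mul_one _).trans hr)).symm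
      rw [hr1, one_mul] at hxr hyr
      exact ⟨hxr, hyr.symm⟩
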